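/- Let B=(G,H) be a pseudo-Laman bigraph with biedge set ℰ without self-loops, and let ē∈ℰ be a bridge in G but not a bridge in H. Fix another biedge ẽ∈ℰ∖{ē}. Then for every N∈ℕ, B has Laman number N with respect to ẽ if and only if the bigraph (G∖{ē}, H∖{ē}) with biedge set ℰ∖{ē} has Laman number N with respect to ẽ. -/

import Mathlib

set_option maxHeartbeats 1000000

noncomputable section
open Classical

namespace LamanPaper

variable {V E : Type}

/-- The adjacency relation induced by an incidence map `ends`. -/
def adjRel (ends : E → Sym2 V) : V → V → Prop := fun u v => ∃ e : E, ends e = s(u, v)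

/-- The setoid of connected components of the graph with incidence map `ends`. -/
def ccSetoid (ends : E → Sym2 V) : Setoid V :=
  ⟨Relation.EqvGen (adjRel ends), Relation.EqvGen.is_equivalence _⟩

/-- The number of connected components. -/
def numCC (ends : E → Sym2 V) : ℕ := Nat.card (Quotient (ccSetoid ends))

/-- The dimension of a graph: number of vertices minus number of connected components. -/
def gDim (ends : E → Sym2 V) : ℕ := Nat.card V - numCC ends

/-- Restriction of a graph to a set of edges. -/
def restrictEnds (ends : E → Sym2 V) (S : Set E) : {e : E // e ∈ S} → Sym2 V :=
  fun e => ends e.1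

/-- Deletion of a set of edges from a graph. -/
def deleteEnds (ends : E → Sym2 V) (S : Set E) : {e : E // e ∉ S} → Sym2 V :=
  fun e => ends e.1

/-- The setoid on vertices generated by contracting the edges in `S`. -/
def contrSetoid (ends : E → Sym2 V) (S : Set E) : Setoid V :=
  ⟨Relation.EqvGen fun u v => ∃ e ∈ S, ends e = s(u, v), Relation.EqvGen.is_equivalence _⟩

/-- Contraction of the edges in `S`: the remaining edges join the equivalence classes of
their endpoints. -/
def contractEnds (ends : E → Sym2 V) (S : Set E) :
    {e : E // e ∉ S} → Sym2 (Quotient (contrSetoid ends S)) :=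
  fun e => (ends e.1).map (Quotient.mk (contrSetoid ends S))

/-- An edge is a bridge if deleting it increases the number of connected components. -/
def IsBridge (ends : E → Sym2 V) (e : E) : Prop :=
  numCC ends < numCC (deleteEnds ends ({e} : Set E))

/-- The smaller endpoint of an (unordered) edge, with respect to a linear order. -/
def sMin [LinearOrder V] (s : Sym2 V) : V :=
  Sym2.lift ⟨fun a b => min a b, fun a b => min_comm a b⟩ s

/-- The larger endpoint of an (unordered) edge, with respect to a linear order. -/
def sMax [LinearOrder V] (s : Sym2 V) : V :=
  Sym2.lift ⟨fun a b => max a b, fun a b => max_comm a b⟩ s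

theorem sMin_mem [LinearOrder V] (s : Sym2 V) : sMin s ∈ s := by
  induction s using Sym2.ind with
  | _ x y => rcases min_choice x y with h | h <;> simp [sMin, Sym2.lift_mk, h, Sym2.mem_iff]

theorem sMax_mem [LinearOrder V] (s : Sym2 V) : sMax s ∈ s := by
  induction s using Sym2.ind with
  | _ x y => rcases max_choice x y with h | h <;> simp [sMax, Sym2.lift_mk, h, Sym2.mem_iff]

/-- A bigraph: a pair of finite multigraphs `G = (V, ℰ)` and `H = (W, ℰ)` sharing the same
set of (bi)edges, together with fixed total orders on the two vertex sets. -/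
structure Bigraph where
  ℰ : Type
  V : Type
  W : Type
  finE : Finite ℰ
  finV : Finite V
  finW : Finite W
  τG : ℰ → Sym2 V
  τH : ℰ → Sym2 W
  ordV : LinearOrder V
  ordW : LinearOrder W

namespace Bigraph

variable (B : Bigraph)

instance : Finite B.ℰ := B.finE
instance : Finite B.V := B.finV
instance : Finite B.W := B.finW

/-- The dimension of the first graph of a bigraph. -/
def dimG : ℕ := gDim B.τG

/-- The dimension of the second graph of a bigraph. -/
def dimH : ℕ := gDim B.τH

/-- A bigraph is pseudo-Laman if `dim G + dim H = |ℰ| + 1`. -/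
def PseudoLaman : Prop := B.dimG + B.dimH = Nat.card B.ℰ + 1

/-- A bigraph has a (self-)loop if some biedge is a self-loop in `G` or in `H`. -/
def HasLoop : Prop := (∃ e, (B.τG e).IsDiag) ∨ (∃ e, (B.τH e).IsDiag)

/-- The set `P` of ordered pairs of distinct vertices of `G` joined by some edge. -/
def Pset : Set (B.V × B.V) := {p | p.1 ≠ p.2 ∧ ∃ e, B.τG e = s(p.1, p.2)}

/-- The set `Q` of ordered pairs of distinct vertices of `H` joined by some edge. -/
def Qset : Set (B.W × B.W) := {q | q.1 ≠ q.2 ∧ ∃ e, B.τH e = s(q.1, q.2)}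

/-- The smaller endpoint (w.r.t. the fixed total order) of a biedge in `G`. -/
def eFstG (e : B.ℰ) : B.V := letI := B.ordV; sMin (B.τG e)

/-- The larger endpoint of a biedge in `G`. -/
def eSndG (e : B.ℰ) : B.V := letI := B.ordV; sMax (B.τG e)

/-- The smaller endpoint of a biedge in `H`. -/
def eFstH (e : B.ℰ) : B.W := letI := B.ordW; sMin (B.τH e)

/-- The larger endpoint of a biedge in `H`. -/
def eSndH (e : B.ℰ) : B.W := letI := B.ordW; sMax (B.τH e)

theorem eFstG_mem (e : B.ℰ) : B.eFstG e ∈ B.τG e := by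
  letI := B.ordV; exact sMin_mem _

theorem eSndG_mem (e : B.ℰ) : B.eSndG e ∈ B.τG e := by
  letI := B.ordV; exact sMax_mem _

theorem eFstH_mem (e : B.ℰ) : B.eFstH e ∈ B.τH e := by
  letI := B.ordW; exact sMin_mem _

theorem eSndH_mem (e : B.ℰ) : B.eSndH e ∈ B.τH e := by
  letI := B.ordW; exact sMax_mem _

/-- The affine solution set `Z^B(λ)` of a bigraph with distinguished biedge `ebar` and
parameters `lam`. -/
def ZSet (ebar : B.ℰ) (lam : {e : B.ℰ // e ≠ ebar} → ℂ) :
    Set ((↥B.Pset → ℂ) × (↥B.Qset → ℂ)) :=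
  {xy |
    (∀ p : ↥B.Pset, (p : B.V × B.V) = (B.eFstG ebar, B.eSndG ebar) → xy.1 p = 1) ∧
    (∀ q : ↥B.Qset, (q : B.W × B.W) = (B.eFstH ebar, B.eSndH ebar) → xy.2 q = 1) ∧
    (∀ e : {e : B.ℰ // e ≠ ebar}, ∀ p : ↥B.Pset, ∀ q : ↥B.Qset,
      (p : B.V × B.V) = (B.eFstG e.1, B.eSndG e.1) →
      (q : B.W × B.W) = (B.eFstH e.1, B.eSndH e.1) →
      xy.1 p * xy.2 q = lam e) ∧
    (∀ (n : ℕ) (u : ℕ → B.V) (w : Fin n → ↥B.Pset),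
      (∀ i : Fin n, (w i : B.V × B.V) = (u i.1, u (i.1 + 1))) → u n = u 0 →
      ∑ i, xy.1 (w i) = 0) ∧
    (∀ (n : ℕ) (u : ℕ → B.W) (w : Fin n → ↥B.Qset),
      (∀ i : Fin n, (w i : B.W × B.W) = (u i.1, u (i.1 + 1))) → u n = u 0 →
      ∑ i, xy.2 (w i) = 0)}

/-- `B` has Laman number `N` with respect to the biedge `ebar`:  there is a nonzero
polynomial `p` in the parameters such that whenever `p` does not vanish, the solution set
`Z^B(λ)` has exactly `N` elements.  By convention a bigraph containing a self-loop has
Laman number `0`. -/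
def HasLamanNumber (ebar : B.ℰ) (N : ℕ) : Prop :=
  (B.HasLoop ∧ N = 0) ∨
  (¬ B.HasLoop ∧ ∃ P : MvPolynomial {e : B.ℰ // e ≠ ebar} ℂ, P ≠ 0 ∧
    ∀ lam : {e : B.ℰ // e ≠ ebar} → ℂ, MvPolynomial.eval lam P ≠ 0 →
      (B.ZSet ebar lam).Finite ∧ Nat.card ↥(B.ZSet ebar lam) = N)

/-- The bigraph obtained by restricting the biedges to a subset `S` (both in `G` and `H`). -/
def restrict (S : Set B.ℰ) : Bigraph where
  ℰ := {e : B.ℰ // e ∈ S}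
  V := B.V
  W := B.W
  finE := Subtype.finite
  finV := B.finV
  finW := B.finW
  τG := fun e => B.τG e.1
  τH := fun e => B.τH e.1
  ordV := B.ordV
  ordW := B.ordW

/-- The bigraph `^M B = (G / M, H ∖ M)`: contract the biedges of `M` in `G` and delete them
in `H`. -/
def ctrG (M : Set B.ℰ) (ord : LinearOrder (Quotient (contrSetoid B.τG M))) : Bigraph where
  ℰ := {e : B.ℰ // e ∉ M}
  V := Quotient (contrSetoid B.τG M)
  W := B.W
  finE := Subtype.finite
  finV := Quotient.finite _
  finW := B.finW
  τG := contractEnds B.τG M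
  τH := fun e => B.τH e.1
  ordV := ord
  ordW := B.ordW

/-- The bigraph `B ^ M = (G ∖ M, H / M)`: delete the biedges of `M` in `G` and contract them
in `H`. -/
def ctrH (M : Set B.ℰ) (ord : LinearOrder (Quotient (contrSetoid B.τH M))) : Bigraph where
  ℰ := {e : B.ℰ // e ∉ M}
  V := B.V
  W := Quotient (contrSetoid B.τH M)
  finE := Subtype.finite
  finV := B.finV
  finW := Quotient.finite _
  τG := fun e => B.τG e.1
  τH := contractEnds B.τH M
  ordV := B.ordV
  ordW := ord

/-! ### Bidistances -/

/-- Symmetry of a function on `P`: `d_V(u,v) = d_V(v,u)`. -/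
def BidistSymmG (dV : ↥B.Pset → ℚ) : Prop :=
  ∀ p p' : ↥B.Pset, (p' : B.V × B.V) = ((p : B.V × B.V).2, (p : B.V × B.V).1) → dV p' = dV p

/-- Symmetry of a function on `Q`: `d_W(t,w) = d_W(w,t)`. -/
def BidistSymmH (dW : ↥B.Qset → ℚ) : Prop :=
  ∀ q q' : ↥B.Qset, (q' : B.W × B.W) = ((q : B.W × B.W).2, (q : B.W × B.W).1) → dW q' = dW q

/-- The sum condition: `d_V(u,v) + d_W(t,w) = wt(e)` for every biedge `e ≠ ebar`. -/
def BidistSum (ebar : B.ℰ) (wt : {e : B.ℰ // e ≠ ebar} → ℚ)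
    (dV : ↥B.Pset → ℚ) (dW : ↥B.Qset → ℚ) : Prop :=
  ∀ e : {e : B.ℰ // e ≠ ebar}, ∀ p : ↥B.Pset, ∀ q : ↥B.Qset,
    s((p : B.V × B.V).1, (p : B.V × B.V).2) = B.τG e.1 →
    s((q : B.W × B.W).1, (q : B.W × B.W).2) = B.τH e.1 →
    dV p + dW q = wt e

/-- The base condition: `d_V(ū,v̄) = d_W(t̄,w̄) = 0` on the distinguished biedge. -/
def BidistBase (ebar : B.ℰ) (dV : ↥B.Pset → ℚ) (dW : ↥B.Qset → ℚ) : Prop :=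
  (∀ p : ↥B.Pset, s((p : B.V × B.V).1, (p : B.V × B.V).2) = B.τG ebar → dV p = 0) ∧
  (∀ q : ↥B.Qset, s((q : B.W × B.W).1, (q : B.W × B.W).2) = B.τH ebar → dW q = 0)

/-- On every closed walk in `G`, the minimum of `d_V` over the consecutive vertex pairs is
attained at least twice. -/
def BidistMinG (dV : ↥B.Pset → ℚ) : Prop :=
  ∀ (n : ℕ) (u : ℕ → B.V) (w : Fin n → ↥B.Pset),
    (∀ i : Fin n, (w i : B.V × B.V) = (u i.1, u (i.1 + 1))) → u n = u 0 →
    ∀ i : Fin n, (∀ k, dV (w i) ≤ dV (w k)) → ∃ j, j ≠ i ∧ dV (w j) = dV (w i)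

/-- On every closed walk in `H`, the minimum of `d_W` over the consecutive vertex pairs is
attained at least twice. -/
def BidistMinH (dW : ↥B.Qset → ℚ) : Prop :=
  ∀ (n : ℕ) (u : ℕ → B.W) (w : Fin n → ↥B.Qset),
    (∀ i : Fin n, (w i : B.W × B.W) = (u i.1, u (i.1 + 1))) → u n = u 0 →
    ∀ i : Fin n, (∀ k, dW (w i) ≤ dW (w k)) → ∃ j, j ≠ i ∧ dW (w j) = dW (w i)

/-- A bidistance on `B` compatible with the weight vector `wt`. -/
def IsBidistance (ebar : B.ℰ) (wt : {e : B.ℰ // e ≠ ebar} → ℚ)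
    (dV : ↥B.Pset → ℚ) (dW : ↥B.Qset → ℚ) : Prop :=
  B.BidistSymmG dV ∧ B.BidistSymmH dW ∧ B.BidistSum ebar wt dV dW ∧
  B.BidistBase ebar dV dW ∧ B.BidistMinG dV ∧ B.BidistMinH dW

/-! ### The quotient bigraph `B_d` -/

/-- The value of `d_V` on (the endpoint pair of) a biedge. -/
def gvalG (dV : ↥B.Pset → ℚ) (e : B.ℰ) : ℚ :=
  if h : ∃ p : ↥B.Pset, s((p : B.V × B.V).1, (p : B.V × B.V).2) = B.τG e then dV h.choose
  else 0

/-- The value of `d_W` on (the endpoint pair of) a biedge. -/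
def gvalH (dW : ↥B.Qset → ℚ) (e : B.ℰ) : ℚ :=
  if h : ∃ q : ↥B.Qset, s((q : B.W × B.W).1, (q : B.W × B.W).2) = B.τH e then dW h.choose
  else 0

/-- Incidences of the graph `G`: pairs of a biedge and one of its endpoints. -/
def IncG := {q : B.ℰ × B.V // q.2 ∈ B.τG q.1}

/-- Incidences of the graph `H`. -/
def IncH := {q : B.ℰ × B.W // q.2 ∈ B.τH q.1}

instance : Finite B.IncG := by unfold IncG; infer_instance
instance : Finite B.IncH := by unfold IncH; infer_instance

/-- Two incidences `(e,v)`, `(e',v')` of `G` are identified in `B_d` if the `d_V`-levels of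
`e` and `e'` agree (say equal to `α`) and `v`, `v'` are connected by edges of level `> α`. -/
def relIncG (dV : ↥B.Pset → ℚ) : B.IncG → B.IncG → Prop := fun a b =>
  B.gvalG dV a.1.1 = B.gvalG dV b.1.1 ∧
  Relation.EqvGen (fun u v => ∃ e, B.gvalG dV a.1.1 < B.gvalG dV e ∧ B.τG e = s(u, v))
    a.1.2 b.1.2

def relIncH (dW : ↥B.Qset → ℚ) : B.IncH → B.IncH → Prop := fun a b =>
  B.gvalH dW a.1.1 = B.gvalH dW b.1.1 ∧
  Relation.EqvGen (fun u v => ∃ e, B.gvalH dW a.1.1 < B.gvalH dW e ∧ B.τH e = s(u, v))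
    a.1.2 b.1.2

def incSetoidG (dV : ↥B.Pset → ℚ) : Setoid B.IncG :=
  ⟨Relation.EqvGen (B.relIncG dV), Relation.EqvGen.is_equivalence _⟩

def incSetoidH (dW : ↥B.Qset → ℚ) : Setoid B.IncH :=
  ⟨Relation.EqvGen (B.relIncH dW), Relation.EqvGen.is_equivalence _⟩

/-- The vertices of the first graph `G_{d_V}` of the quotient bigraph `B_d`:
classes of incidences.  This realizes the disjoint union of the contractions
`G_{≥α} / G_{>α}` (with isolated vertices discarded). -/
def QVertG (dV : ↥B.Pset → ℚ) := Quotient (B.incSetoidG dV)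

def QVertH (dW : ↥B.Qset → ℚ) := Quotient (B.incSetoidH dW)

/-- The incidence map of `G_{d_V}`. -/
def quotEndsG (dV : ↥B.Pset → ℚ) : B.ℰ → Sym2 (B.QVertG dV) := fun e =>
  s(Quotient.mk (B.incSetoidG dV) ⟨(e, B.eFstG e), B.eFstG_mem e⟩,
    Quotient.mk (B.incSetoidG dV) ⟨(e, B.eSndG e), B.eSndG_mem e⟩)

/-- The incidence map of `H_{d_W}`. -/
def quotEndsH (dW : ↥B.Qset → ℚ) : B.ℰ → Sym2 (B.QVertH dW) := fun e =>
  s(Quotient.mk (B.incSetoidH dW) ⟨(e, B.eFstH e), B.eFstH_mem e⟩,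
    Quotient.mk (B.incSetoidH dW) ⟨(e, B.eSndH e), B.eSndH_mem e⟩)

/-- The quotient bigraph `B_d = (G_{d_V}, H_{d_W})` of a bigraph by a bidistance `(d_V, d_W)`,
with arbitrarily fixed total orders on the new vertex sets.  It has the same biedges as `B`. -/
def quotBigraph (dV : ↥B.Pset → ℚ) (dW : ↥B.Qset → ℚ)
    (oV : LinearOrder (B.QVertG dV)) (oW : LinearOrder (B.QVertH dW)) : Bigraph where
  ℰ := B.ℰ
  V := B.QVertG dV
  W := B.QVertH dW
  finE := B.finE
  finV := Quotient.finite _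
  finW := Quotient.finite _
  τG := B.quotEndsG dV
  τH := B.quotEndsH dW
  ordV := oV
  ordW := oW

/-! ### Untangling -/

/-- `B` untangles via the biedge `ebar` with respect to the decomposition
`ℰ = E1 ⊔ E2 ⊔ {ebar}`, `V = V1 ⊔ V2`, `W = W1 ⊔ W2`:  the graph `G` is the disjoint union
of the subgraph on `V1` with edges `E1 ∪ {ebar}` and the subgraph on `V2` with edges `E2`,
while `H` is the disjoint union of the subgraph on `W1` with edges `E1` and the subgraph on
`W2` with edges `E2 ∪ {ebar}`.  The two bigraphs into which `B` untangles are then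
`B₁ = B.restrict E1` and `B₂ = B.restrict E2`. -/
def Untangles (ebar : B.ℰ) (E1 E2 : Set B.ℰ) (V1 V2 : Set B.V) (W1 W2 : Set B.W) : Prop :=
  ebar ∉ E1 ∧ ebar ∉ E2 ∧ E1 ∩ E2 = ∅ ∧ (∀ e : B.ℰ, e = ebar ∨ e ∈ E1 ∨ e ∈ E2) ∧
  V1 ∩ V2 = ∅ ∧ V1 ∪ V2 = Set.univ ∧
  (∀ e ∈ E1, ∀ v, v ∈ B.τG e → v ∈ V1) ∧ (∀ v, v ∈ B.τG ebar → v ∈ V1) ∧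
  (∀ e ∈ E2, ∀ v, v ∈ B.τG e → v ∈ V2) ∧
  W1 ∩ W2 = ∅ ∧ W1 ∪ W2 = Set.univ ∧
  (∀ e ∈ E1, ∀ x, x ∈ B.τH e → x ∈ W1) ∧
  (∀ e ∈ E2, ∀ x, x ∈ B.τH e → x ∈ W2) ∧ (∀ x, x ∈ B.τH ebar → x ∈ W2)

/-! ### The rational map `f_B` -/

/-- The vector of coordinates of the rational map `f_B`, evaluated on representatives
`x : V → ℂ` and `y : W → ℂ`:  the `e`-th coordinate is `(x_u - x_v)(y_t - y_w)` where
`{u,v} = τ_G(e)` with `u ≺ v` and `{t,w} = τ_H(e)` with `t ≺ w`.  (For a self-loop the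
corresponding factor is `0`.) -/
def fVec (x : B.V → ℂ) (y : B.W → ℂ) : B.ℰ → ℂ :=
  fun e => (x (B.eFstG e) - x (B.eSndG e)) * (y (B.eFstH e) - y (B.eSndH e))

/-- The subspace `L_G` of vectors that are constant on each connected component of `G`. -/
def LG : Submodule ℂ (B.V → ℂ) where
  carrier := {x | ∀ u v : B.V, Relation.EqvGen (adjRel B.τG) u v → x u = x v}
  add_mem' := by
    intro a b ha hb u v h
    simp only [Pi.add_apply, ha u v h, hb u v h]
  zero_mem' := by intro u v _; rfl
  smul_mem' := by
    intro c a ha u v h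
    simp only [Pi.smul_apply, ha u v h]

/-- The subspace `L_H` of vectors that are constant on each connected component of `H`. -/
def LH : Submodule ℂ (B.W → ℂ) where
  carrier := {y | ∀ u v : B.W, Relation.EqvGen (adjRel B.τH) u v → y u = y v}
  add_mem' := by
    intro a b ha hb u v h
    simp only [Pi.add_apply, ha u v h, hb u v h]
  zero_mem' := by intro u v _; rfl
  smul_mem' := by
    intro c a ha u v h
    simp only [Pi.smul_apply, ha u v h]

/-- Dominance of the rational map `f_B`:  the image of `f_B` is not contained in any
proper algebraic subset of `ℙ(ℂ^ℰ)`, equivalently in no zero set of a nonzero homogeneous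
polynomial. -/
def FDominant : Prop :=
  ¬ ∃ (n : ℕ) (P : MvPolynomial B.ℰ ℂ), P ≠ 0 ∧ P.IsHomogeneous n ∧
      ∀ (x : B.V → ℂ) (y : B.W → ℂ), MvPolynomial.eval (B.fVec x y) P = 0

end Bigraph


/-- There is a walk from `u` to `v` with total `x`-value `s`. -/
inductive WS {V : Type} {P : Set (V × V)} (x : ↥P → ℂ) : V → V → ℂ → Prop
  | nil (u : V) : WS x u u 0
  | snoc {u : V} {s : ℂ} (p : ↥P) (h : WS x u p.1.1 s) : WS x u p.1.2 (s + x p)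

theorem WS.toWalk {V : Type} {P : Set (V × V)} {x : ↥P → ℂ} {u v : V} {s : ℂ}
    (h : WS x u v s) : ∃ (n : ℕ) (f : ℕ → V) (w : Fin n → ↥P),
      (∀ i : Fin n, (w i : V × V) = (f i.1, f (i.1 + 1))) ∧ f 0 = u ∧ f n = v ∧
      ∑ i, x (w i) = s := by
  induction h with
  | nil => exact ⟨0, fun _ => u, Fin.elim0, fun i => i.elim0, rfl, rfl, by simp⟩
  | snoc p h ih =>
    obtain ⟨n, f, w, h1, h2, h3, h4⟩ := ih
    refine ⟨n + 1, Function.update f (n + 1) p.1.2, Fin.snoc w p, ?_, ?_, ?_, ?_⟩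
    · intro i
      refine Fin.lastCases ?_ (fun i => ?_) i
      · simp [Function.update, h3]
      · have := i.2
        simp only [Fin.snoc_castSucc, h1, Fin.val_castSucc]
        rw [Function.update_of_ne (by omega), Function.update_of_ne (by omega)]
    · rw [Function.update_of_ne (by omega), h2]
    · simp
    · rw [Fin.sum_univ_castSucc]; simp [h4]

theorem WS.trans {V : Type} {P : Set (V × V)} {x : ↥P → ℂ} {u v w : V} {s t : ℂ}
    (h : WS x u v s) (h' : WS x v w t) : WS x u w (s + t) := by
  induction h' with
  | nil => simpa using h
  | snoc p h' ih => rw [← add_assoc]; exact WS.snoc p ih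

theorem exists_potential {V : Type} (P : Set (V × V)) (hP : ∀ u v, (u, v) ∈ P → (v, u) ∈ P)
    (x : ↥P → ℂ)
    (hx : ∀ (n : ℕ) (u : ℕ → V) (w : Fin n → ↥P),
      (∀ i : Fin n, (w i : V × V) = (u i.1, u (i.1 + 1))) → u n = u 0 →
      ∑ i, x (w i) = 0) :
    ∃ a : V → ℂ, ∀ p : ↥P, x p = a p.1.2 - a p.1.1 := by
  have hcl : ∀ u s, WS x u u s → s = 0 := by
    intro u s h
    obtain ⟨n, f, w, h1, h2, h3, h4⟩ := h.toWalk
    rw [← h4]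
    exact hx n f w h1 (h3.trans h2.symm)
  have hone : ∀ p : ↥P, WS x p.1.1 p.1.2 (x p) := by
    intro p
    simpa using WS.snoc p (WS.nil (x := x) p.1.1)
  have hrev1 : ∀ p : ↥P, WS x p.1.2 p.1.1 (- x p) := by
    intro p
    have h1 := hone ⟨(p.1.2, p.1.1), hP _ _ p.2⟩
    have h2 := hcl _ _ ((hone p).trans h1)
    rw [← eq_neg_of_add_eq_zero_right h2]
    exact h1
  have hrev : ∀ u v s, WS x u v s → WS x v u (-s) := by
    intro u v s h
    induction h with
    | nil => simpa using WS.nil (x := x) u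
    | snoc p h ih =>
      rw [neg_add_rev]
      exact (hrev1 p).trans ih
  have huniq : ∀ u v s t, WS x u v s → WS x u v t → s = t := by
    intro u v s t h h'
    have := hcl _ _ (h.trans (hrev _ _ _ h'))
    linear_combination this
  let S : Setoid V := ⟨fun u v => ∃ s, WS x u v s,
    ⟨fun u => ⟨0, WS.nil u⟩, fun ⟨s, h⟩ => ⟨_, hrev _ _ _ h⟩,
      fun ⟨s, h⟩ ⟨t, h'⟩ => ⟨_, h.trans h'⟩⟩⟩
  have hr : ∀ v, ∃ s, WS x (Quotient.mk S v).out v s := fun v => Quotient.mk_out (s := S) v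
  choose a ha using hr
  refine ⟨a, fun p => ?_⟩
  have he : Quotient.mk S p.1.1 = Quotient.mk S p.1.2 := Quotient.sound ⟨_, hone p⟩
  have h1 := (ha p.1.1).trans (hone p)
  rw [he] at h1
  have := huniq _ _ _ _ h1 (ha p.1.2)
  linear_combination this

theorem closed_of_potential {V : Type} (P : Set (V × V)) (x : ↥P → ℂ) (a : V → ℂ)
    (ha : ∀ p : ↥P, x p = a p.1.2 - a p.1.1)
    (n : ℕ) (u : ℕ → V) (w : Fin n → ↥P)
    (hw : ∀ i : Fin n, (w i : V × V) = (u i.1, u (i.1 + 1))) (hu : u n = u 0) :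
    ∑ i, x (w i) = 0 := by
  have : ∀ i : Fin n, x (w i) = (fun k : ℕ => a (u (k + 1)) - a (u k)) i.1 := by
    intro i
    rw [ha, hw]
  rw [Finset.sum_congr rfl (fun i _ => this i), Fin.sum_univ_eq_sum_range
    (fun k : ℕ => a (u (k + 1)) - a (u k)), Finset.sum_range_sub (fun k => a (u k)), hu, sub_self]

theorem alg_dep {ι M N : Type} [Finite ι] [AddCommGroup M] [Module ℂ M] [FiniteDimensional ℂ M]
    [AddCommGroup N] [Module ℂ N] [FiniteDimensional ℂ N]
    (φ : ι → M →ₗ[ℂ] ℂ) (ψ : ι → N →ₗ[ℂ] ℂ) (c d : ι → ℂ)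
    (hlt : Module.finrank ℂ M + Module.finrank ℂ N < Nat.card ι) :
    ∃ q : MvPolynomial ι ℂ, q ≠ 0 ∧ ∀ m n,
      MvPolynomial.eval (fun i => (c i + φ i m) * (d i + ψ i n)) q = 0 := by
  let bM := Module.finBasis ℂ M
  let bN := Module.finBasis ℂ N
  let σ := Fin (Module.finrank ℂ M) ⊕ Fin (Module.finrank ℂ N)
  let f : ι → MvPolynomial σ ℂ := fun i =>
    (MvPolynomial.C (c i) + ∑ k, MvPolynomial.C (φ i (bM k)) * MvPolynomial.X (Sum.inl k)) *
    (MvPolynomial.C (d i) + ∑ k, MvPolynomial.C (ψ i (bN k)) * MvPolynomial.X (Sum.inr k))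
  have hna : ¬ AlgebraicIndependent ℂ f := by
    intro h
    have h1 := h.cardinalMk_le_trdeg
    rw [MvPolynomial.trdeg_of_isDomain, Cardinal.lift_id] at h1
    have h2 : Nat.card ι ≤ Nat.card σ := by
      have := Cardinal.toNat_le_toNat h1 (Cardinal.mk_lt_aleph0)
      exact this
    simp [σ] at h2
    omega
  have : ∃ q : MvPolynomial ι ℂ, MvPolynomial.aeval f q = 0 ∧ q ≠ 0 := by
    by_contra hc
    push Not at hc
    exact hna (algebraicIndependent_iff.2 hc)
  obtain ⟨q, hq, hq0⟩ := this
  refine ⟨q, hq0, fun m n => ?_⟩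
  let pt : σ → ℂ := Sum.elim (fun k => bM.repr m k) (fun k => bN.repr n k)
  have h1 : MvPolynomial.eval pt (MvPolynomial.aeval f q) = 0 := by rw [hq]; simp
  have h2 : MvPolynomial.eval pt (MvPolynomial.aeval f q) =
      MvPolynomial.eval (fun i => MvPolynomial.eval pt (f i)) q := by
    rw [MvPolynomial.aeval_def, MvPolynomial.hom_eval₂, MvPolynomial.eval, MvPolynomial.eval,
      MvPolynomial.coe_eval₂Hom]
    congr 1
    ext z
    simp
  rw [h2] at h1
  rw [← h1]
  congr 2
  funext i
  have hm : φ i m = ∑ k, φ i (bM k) * bM.repr m k := by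
    conv_lhs => rw [← bM.sum_repr m]
    rw [map_sum]
    simp only [map_smul, smul_eq_mul, mul_comm]
  have hn : ψ i n = ∑ k, ψ i (bN k) * bN.repr n k := by
    conv_lhs => rw [← bN.sum_repr n]
    rw [map_sum]
    simp only [map_smul, smul_eq_mul, mul_comm]
  simp [f, pt, hm, hn]

/-- The difference map. -/
def diffMap {V E : Type} [LinearOrder V] (ends : E → Sym2 V) : (V → ℂ) →ₗ[ℂ] (E → ℂ) where
  toFun a := fun e => a (sMax (ends e)) - a (sMin (ends e))
  map_add' a b := by funext e; simp; ring
  map_smul' c a := by funext e; simp; ring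

theorem sMinMax {V : Type} [LinearOrder V] (s : Sym2 V) : s(sMin s, sMax s) = s := by
  induction s using Sym2.ind with
  | _ x y =>
    rcases le_total x y with h | h <;> simp [sMin, sMax, Sym2.lift_mk, h, Sym2.eq_swap]

theorem finrank_diff {V E : Type} [Finite V] [LinearOrder V] (ends : E → Sym2 V) :
    Module.finrank ℂ (LinearMap.range (diffMap ends)) + numCC ends ≤ Nat.card V := by
  have := Fintype.ofFinite V
  have h := LinearMap.finrank_range_add_finrank_ker (diffMap ends)
  rw [Module.finrank_fintype_fun_eq_card, ← Nat.card_eq_fintype_card] at h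
  suffices numCC ends ≤ Module.finrank ℂ (LinearMap.ker (diffMap ends)) by omega
  have := Fintype.ofFinite (Quotient (ccSetoid ends))
  have hk : ∀ g : Quotient (ccSetoid ends) → ℂ,
      (LinearMap.funLeft ℂ ℂ (Quotient.mk (ccSetoid ends))) g ∈ LinearMap.ker (diffMap ends) := by
    intro g
    rw [LinearMap.mem_ker]
    funext e
    have : Quotient.mk (ccSetoid ends) (sMin (ends e)) = Quotient.mk (ccSetoid ends) (sMax (ends e)) :=
      Quotient.sound (Relation.EqvGen.rel _ _ ⟨e, (sMinMax _).symm⟩)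
    simp [diffMap, LinearMap.funLeft_apply, this]
  let L := (LinearMap.funLeft ℂ ℂ (Quotient.mk (ccSetoid ends))).codRestrict _ hk
  have hL : Function.Injective L := by
    intro g g' hg
    have := congrArg Subtype.val hg
    exact LinearMap.funLeft_injective_of_surjective ℂ ℂ _ Quotient.mk_surjective this
  have := LinearMap.finrank_le_finrank_of_injective hL
  rw [Module.finrank_fintype_fun_eq_card, ← Nat.card_eq_fintype_card] at this
  exact this

theorem cc_mono {V E : Type} (ends : E → Sym2 V) (S : Set E) {u v : V}
    (h : Relation.EqvGen (adjRel (deleteEnds ends S)) u v) : Relation.EqvGen (adjRel ends) u v := by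
  induction h with
  | rel a b hab =>
    obtain ⟨k, hk⟩ := hab
    exact Relation.EqvGen.rel _ _ ⟨k.1, hk⟩
  | refl a => exact Relation.EqvGen.refl a
  | symm a b _ ih => exact ih.symm
  | trans a b c _ _ ih1 ih2 => exact ih1.trans _ _ _ ih2

theorem cc_not_bridge {V E : Type} [Finite V] (ends : E → Sym2 V) (e : E)
    (h : ¬ IsBridge ends e) {u v : V} (he : ends e = s(u, v)) :
    Relation.EqvGen (adjRel (deleteEnds ends ({e} : Set E))) u v := by
  let g : Quotient (ccSetoid (deleteEnds ends ({e} : Set E))) → Quotient (ccSetoid ends) :=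
    Quotient.map id (fun a b hab => cc_mono ends _ hab)
  have hg : Function.Surjective g := by
    intro z
    induction z using Quotient.ind with
    | _ z => exact ⟨Quotient.mk _ z, rfl⟩
  have hc : Nat.card (Quotient (ccSetoid (deleteEnds ends ({e} : Set E)))) ≤
      Nat.card (Quotient (ccSetoid ends)) := not_lt.1 h
  have hb := hg.bijective_of_nat_card_le hc
  have : g (Quotient.mk _ u) = g (Quotient.mk _ v) :=
    Quotient.sound (Relation.EqvGen.rel _ _ ⟨e, he⟩)
  exact Quotient.exact (hb.1 this)

theorem cc_bridge {V E : Type} (ends : E → Sym2 V) (e : E)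
    (h : IsBridge ends e) {u v : V} (he : ends e = s(u, v)) :
    ¬ Relation.EqvGen (adjRel (deleteEnds ends ({e} : Set E))) u v := by
  intro hc
  refine absurd h (not_lt.2 (le_of_eq ?_))
  unfold numCC
  congr 2
  ext a b
  constructor
  · exact fun hab => cc_mono ends _ hab
  · intro hab
    induction hab with
    | rel a b hab =>
      obtain ⟨k, hk⟩ := hab
      by_cases hke : k = e
      · subst hke
        rw [he] at hk
        rcases Sym2.eq_iff.1 hk with ⟨rfl, rfl⟩ | ⟨rfl, rfl⟩
        · exact hc
        · exact hc.symm
      · exact Relation.EqvGen.rel _ _ ⟨⟨k, hke⟩, hk⟩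
    | refl a => exact Relation.EqvGen.refl a
    | symm a b _ ih => exact ih.symm
    | trans a b c _ _ ih1 ih2 => exact ih1.trans _ _ _ ih2

namespace Bigraph

/-- Difference of a potential along a biedge in `G`. -/
def dG (B : Bigraph) (a : B.V → ℂ) (e : B.ℰ) : ℂ := a (B.eSndG e) - a (B.eFstG e)

/-- Difference of a potential along a biedge in `H`. -/
def dH (B : Bigraph) (b : B.W → ℂ) (e : B.ℰ) : ℂ := b (B.eSndH e) - b (B.eFstH e)

theorem endsG (B : Bigraph) (e : B.ℰ) : s(B.eFstG e, B.eSndG e) = B.τG e := by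
  let := B.ordV
  exact sMinMax _

theorem endsH (B : Bigraph) (e : B.ℰ) : s(B.eFstH e, B.eSndH e) = B.τH e := by
  let := B.ordW
  exact sMinMax _

theorem neG (B : Bigraph) (h : ¬ B.HasLoop) (e : B.ℰ) : B.eFstG e ≠ B.eSndG e := by
  intro h'
  refine h (Or.inl ⟨e, ?_⟩)
  rw [← B.endsG, h']
  simp

theorem neH (B : Bigraph) (h : ¬ B.HasLoop) (e : B.ℰ) : B.eFstH e ≠ B.eSndH e := by
  intro h'
  refine h (Or.inr ⟨e, ?_⟩)
  rw [← B.endsH, h']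
  simp

theorem memP (B : Bigraph) (h : ¬ B.HasLoop) (e : B.ℰ) : (B.eFstG e, B.eSndG e) ∈ B.Pset :=
  ⟨B.neG h e, e, (B.endsG e).symm⟩

theorem memQ (B : Bigraph) (h : ¬ B.HasLoop) (e : B.ℰ) : (B.eFstH e, B.eSndH e) ∈ B.Qset :=
  ⟨B.neH h e, e, (B.endsH e).symm⟩

theorem mem_ZSet (B : Bigraph) (h : ¬ B.HasLoop) (et : B.ℰ) (lam : {e : B.ℰ // e ≠ et} → ℂ)
    (xy : (↥B.Pset → ℂ) × (↥B.Qset → ℂ)) :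
    xy ∈ B.ZSet et lam ↔ ∃ (a : B.V → ℂ) (b : B.W → ℂ),
      (∀ p : ↥B.Pset, xy.1 p = a p.1.2 - a p.1.1) ∧
      (∀ q : ↥B.Qset, xy.2 q = b q.1.2 - b q.1.1) ∧
      B.dG a et = 1 ∧ B.dH b et = 1 ∧
      ∀ e : {e : B.ℰ // e ≠ et}, B.dG a e.1 * B.dH b e.1 = lam e := by
  constructor
  · rintro ⟨h1, h2, h3, h4, h5⟩
    obtain ⟨a, ha⟩ := exists_potential B.Pset
      (fun u v ⟨h, e, he⟩ => ⟨Ne.symm h, e, he.trans Sym2.eq_swap⟩) xy.1 h4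
    obtain ⟨b, hb⟩ := exists_potential B.Qset
      (fun u v ⟨h, e, he⟩ => ⟨Ne.symm h, e, he.trans Sym2.eq_swap⟩) xy.2 h5
    refine ⟨a, b, ha, hb, ?_, ?_, ?_⟩
    · rw [← h1 ⟨_, B.memP h et⟩ rfl, ha]; rfl
    · rw [← h2 ⟨_, B.memQ h et⟩ rfl, hb]; rfl
    · intro e
      rw [← h3 e ⟨_, B.memP h e⟩ ⟨_, B.memQ h e⟩ rfl rfl, ha, hb]; rfl
  · rintro ⟨a, b, ha, hb, h1, h2, h3⟩
    refine ⟨?_, ?_, ?_, closed_of_potential _ _ a ha, closed_of_potential _ _ b hb⟩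
    · intro p hp; rw [ha, hp]; exact h1
    · intro p hp; rw [hb, hp]; exact h2
    · intro e p q hp hq; rw [ha, hb, hp, hq]; exact h3 e

theorem generic (B : Bigraph) (hloop : ¬ B.HasLoop) (hpl : B.PseudoLaman)
    (ebar : B.ℰ) (hG : IsBridge B.τG ebar)
    (etil : B.ℰ) (hne : etil ≠ ebar) :
    ∃ q : MvPolynomial {e : (B.restrict {e : B.ℰ | e ≠ ebar}).ℰ // e ≠ ⟨etil, hne⟩} ℂ,
      q ≠ 0 ∧ ∀ a b, B.dG a etil = 1 → B.dH b etil = 1 → B.dH b ebar = 0 →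
        MvPolynomial.eval (fun e => B.dG a e.1.1 * B.dH b e.1.1) q = 0 := by
  by_cases hex : ∃ a b, B.dG a etil = 1 ∧ B.dH b etil = 1 ∧ B.dH b ebar = 0
  swap
  · exact ⟨1, one_ne_zero, fun a b h1 h2 h3 => absurd ⟨a, b, h1, h2, h3⟩ hex⟩
  obtain ⟨a₀, b₀, h1, h2, h3⟩ := hex
  let := B.ordV
  let := B.ordW
  have := Fintype.ofFinite B.ℰ
  let τ' := deleteEnds B.τG ({ebar} : Set B.ℰ)
  let X := LinearMap.range (diffMap τ')
  let Y := LinearMap.range (diffMap B.τH)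
  let et : {e : B.ℰ // e ∉ ({ebar} : Set B.ℰ)} := ⟨etil, hne⟩
  let KX := X ⊓ LinearMap.ker (LinearMap.proj (R := ℂ) (φ := fun _ => ℂ) et)
  let Y1 := Y ⊓ LinearMap.ker (LinearMap.proj (R := ℂ) (φ := fun _ => ℂ) ebar)
  let KY := Y1 ⊓ LinearMap.ker (LinearMap.proj (R := ℂ) (φ := fun _ => ℂ) etil)
  have hKX : KX < X := by
    refine lt_of_le_of_ne inf_le_left (fun hh => ?_)
    have : diffMap τ' a₀ ∈ KX := by rw [hh]; exact ⟨a₀, rfl⟩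
    have h0 : B.dG a₀ etil = 0 := this.2
    rw [h1] at h0
    exact one_ne_zero h0
  have hY1 : Y1 < Y := by
    refine lt_of_le_of_ne inf_le_left (fun hh => ?_)
    have : diffMap B.τH (Pi.single (B.eSndH ebar) 1) ∈ Y1 := by rw [hh]; exact ⟨_, rfl⟩
    have h0 : B.dH (Pi.single (B.eSndH ebar) 1) ebar = 0 := this.2
    simp [dH, Pi.single_apply, B.neH hloop ebar] at h0
  have hKY : KY < Y1 := by
    refine lt_of_le_of_ne inf_le_left (fun hh => ?_)
    have : diffMap B.τH b₀ ∈ KY := by rw [hh]; exact ⟨⟨_, rfl⟩, h3⟩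
    have h0 : B.dH b₀ etil = 0 := this.2
    rw [h2] at h0
    exact one_ne_zero h0
  have f1 := Submodule.finrank_lt_finrank_of_lt hKX
  have f2 := Submodule.finrank_lt_finrank_of_lt hY1
  have f3 := Submodule.finrank_lt_finrank_of_lt hKY
  have f4 : Module.finrank ℂ X + numCC τ' ≤ Nat.card B.V := finrank_diff τ'
  have f5 : Module.finrank ℂ Y + numCC B.τH ≤ Nat.card B.W := finrank_diff B.τH
  have f6 : numCC B.τG < numCC τ' := hG
  have f7 : (Nat.card B.V - numCC B.τG) + (Nat.card B.W - numCC B.τH) = Nat.card B.ℰ + 1 := hpl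
  let ι := {e : (B.restrict {e : B.ℰ | e ≠ ebar}).ℰ // e ≠ ⟨etil, hne⟩}
  have : Finite ι := Subtype.finite
  have f8 : Nat.card ι + 2 = Nat.card B.ℰ := by
    have g1 : Nat.card {e : B.ℰ // e ≠ ebar} + 1 = Nat.card B.ℰ := by
      have := Fintype.card_pos_iff.2 ⟨ebar⟩
      simp [Fintype.card_subtype_compl]
      omega
    have g2 : Nat.card {e : {e : B.ℰ // e ≠ ebar} // e ≠ ⟨etil, hne⟩} + 1 =
        Nat.card {e : B.ℰ // e ≠ ebar} := by
      have := Fintype.card_pos_iff.2 ⟨(⟨etil, hne⟩ : {e : B.ℰ // e ≠ ebar})⟩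
      rw [Nat.card_eq_fintype_card, Nat.card_eq_fintype_card, Fintype.card_subtype_compl]
      simp
      simp at this
      omega
    have g3 : Nat.card ι = Nat.card {e : {e : B.ℰ // e ≠ ebar} // e ≠ ⟨etil, hne⟩} := rfl
    omega
  obtain ⟨q, hq0, hq⟩ := alg_dep (ι := ι) (M := KX) (N := KY)
    (fun i => (LinearMap.proj (R := ℂ) (φ := fun _ => ℂ)
      (⟨i.1.1, i.1.2⟩ : {e : B.ℰ // e ∉ ({ebar} : Set B.ℰ)})) ∘ₗ KX.subtype)
    (fun i => (LinearMap.proj (R := ℂ) (φ := fun _ => ℂ) i.1.1) ∘ₗ KY.subtype)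
    (fun i => B.dG a₀ i.1.1) (fun i => B.dH b₀ i.1.1) (by omega)
  refine ⟨q, hq0, fun a b k1 k2 k3 => ?_⟩
  have m1 : diffMap τ' (a - a₀) ∈ KX := by
    refine ⟨⟨_, rfl⟩, ?_⟩
    change B.dG (a - a₀) etil = 0
    have : B.dG (a - a₀) etil = B.dG a etil - B.dG a₀ etil := by simp [dG]; ring
    rw [this, k1, h1, sub_self]
  have hd : ∀ e, B.dH (b - b₀) e = B.dH b e - B.dH b₀ e := by intro e; simp [dH]; ring
  have m2 : diffMap B.τH (b - b₀) ∈ KY := by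
    refine ⟨⟨⟨_, rfl⟩, ?_⟩, ?_⟩
    · change B.dH (b - b₀) ebar = 0
      rw [hd, k3, h3, sub_self]
    · change B.dH (b - b₀) etil = 0
      rw [hd, k2, h2, sub_self]
  rw [← hq ⟨_, m1⟩ ⟨_, m2⟩]
  congr 2
  funext i
  have e1 : B.dG a i.1.1 = B.dG a₀ i.1.1 + B.dG (a - a₀) i.1.1 := by simp [dG]; ring
  have e2 : B.dH b i.1.1 = B.dH b₀ i.1.1 + B.dH (b - b₀) i.1.1 := by simp [dH]; ring
  rw [e1, e2]
  rfl

/-- Restriction of tuples. -/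
def resMap (B : Bigraph) (S : Set B.ℰ) (xy : (↥B.Pset → ℂ) × (↥B.Qset → ℂ)) :
    (↥(B.restrict S).Pset → ℂ) × (↥(B.restrict S).Qset → ℂ) :=
  (fun p => xy.1 ⟨p.1, p.2.1, by obtain ⟨e, he⟩ := p.2.2; exact ⟨e.1, he⟩⟩,
   fun q => xy.2 ⟨q.1, q.2.1, by obtain ⟨e, he⟩ := q.2.2; exact ⟨e.1, he⟩⟩)

theorem const_cc {V E : Type} (ends : E → Sym2 V) (c : V → ℂ)
    (hc : ∀ e u v, ends e = s(u, v) → c u = c v) {u v : V}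
    (h : Relation.EqvGen (adjRel ends) u v) : c u = c v := by
  induction h with
  | rel a b hab =>
    obtain ⟨k, hk⟩ := hab
    exact hc _ _ _ hk
  | refl a => rfl
  | symm a b _ ih => exact ih.symm
  | trans a b c _ _ ih1 ih2 => exact ih1.trans ih2

theorem bijOn (B : Bigraph) (hloop : ¬ B.HasLoop)
    (ebar : B.ℰ) (hG : IsBridge B.τG ebar) (hH : ¬ IsBridge B.τH ebar)
    (etil : B.ℰ) (hne : etil ≠ ebar)
    (hloop' : ¬ (B.restrict {e : B.ℰ | e ≠ ebar}).HasLoop)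
    (lam : {e : B.ℰ // e ≠ etil} → ℂ)
    (lam' : {e : (B.restrict {e : B.ℰ | e ≠ ebar}).ℰ // e ≠ ⟨etil, hne⟩} → ℂ)
    (hlam : ∀ e (he : e ≠ ebar) (he' : e ≠ etil),
      lam' ⟨⟨e, he⟩, fun hh => he' (congrArg Subtype.val hh)⟩ = lam ⟨e, he'⟩)
    (hl0 : lam ⟨ebar, hne.symm⟩ ≠ 0)
    (hgen : ∀ a b, B.dG a etil = 1 → B.dH b etil = 1 →
      (∀ e : {e : (B.restrict {e : B.ℰ | e ≠ ebar}).ℰ // e ≠ ⟨etil, hne⟩},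
        B.dG a e.1.1 * B.dH b e.1.1 = lam' e) → B.dH b ebar ≠ 0) :
    Set.BijOn (B.resMap {e : B.ℰ | e ≠ ebar}) (B.ZSet etil lam)
      ((B.restrict {e : B.ℰ | e ≠ ebar}).ZSet ⟨etil, hne⟩ lam') := by
  refine ⟨?_, ?_, ?_⟩
  · intro xy hxy
    obtain ⟨a, b, ha, hb, h1, h2, h3⟩ := (B.mem_ZSet hloop _ _ _).1 hxy
    refine (mem_ZSet _ hloop' _ _ _).2 ⟨a, b, fun p => ha _, fun q => hb _, h1, h2, ?_⟩
    rintro ⟨⟨e, he⟩, he'⟩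
    have he'' : e ≠ etil := fun hh => he' (Subtype.ext hh)
    exact (h3 ⟨e, he''⟩).trans (hlam e he he'').symm
  · intro xy hxy xy' hxy' heq
    obtain ⟨a, b, ha, hb, h1, h2, h3⟩ := (B.mem_ZSet hloop _ _ _).1 hxy
    obtain ⟨a', b', ha', hb', h1', h2', h3'⟩ := (B.mem_ZSet hloop _ _ _).1 hxy'
    have hx : ∀ p e, (hp : p ∈ B.Pset) → e ≠ ebar → B.τG e = s(p.1, p.2) →
        xy.1 ⟨p, hp⟩ = xy'.1 ⟨p, hp⟩ := fun p e hp he hep =>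
      congrFun (congrArg Prod.fst heq) ⟨p, hp.1, ⟨e, he⟩, hep⟩
    have hy : ∀ p e, (hp : p ∈ B.Qset) → e ≠ ebar → B.τH e = s(p.1, p.2) →
        xy.2 ⟨p, hp⟩ = xy'.2 ⟨p, hp⟩ := fun p e hp he hep =>
      congrFun (congrArg Prod.snd heq) ⟨p, hp.1, ⟨e, he⟩, hep⟩
    have hb2 : ∀ u v, B.τH ebar = s(u, v) → b v - b u = b' v - b' u := by
      intro u v huv
      have := const_cc (deleteEnds B.τH ({ebar} : Set B.ℰ)) (b - b') (by
        rintro ⟨e, he⟩ s t hst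
        have hst' : B.τH e = s(s, t) := hst
        have hQ : (s, t) ∈ B.Qset := by
          refine ⟨?_, e, hst'⟩
          rintro (rfl : s = t)
          exact hloop (Or.inr ⟨e, by rw [hst']; simp⟩)
        have := hy (s, t) e hQ he hst'
        rw [hb, hb'] at this
        simp only [Pi.sub_apply]
        simp only at this
        linear_combination -this) (cc_not_bridge B.τH ebar hH huv)
      simp only [Pi.sub_apply] at this
      linear_combination -this
    have hyy : xy.2 = xy'.2 := by
      funext ⟨q, hq⟩
      obtain ⟨e, he⟩ := hq.2
      by_cases hee : e = ebar
      · subst hee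
        rw [hb, hb']
        exact hb2 _ _ he
      · exact hy q e hq hee he
    have key : B.dG a ebar = B.dG a' ebar := by
      have k1 := h3 ⟨ebar, hne.symm⟩
      have k2 := h3' ⟨ebar, hne.symm⟩
      have k3 : B.dH b ebar = B.dH b' ebar := hb2 _ _ (B.endsH ebar).symm
      rw [← k3] at k2
      have k4 : B.dH b ebar ≠ 0 := by
        intro h0
        simp only [h0, mul_zero] at k1
        exact hl0 k1.symm
      exact mul_right_cancel₀ k4 (k1.trans k2.symm)
    have hxx : xy.1 = xy'.1 := by
      funext ⟨p, hp⟩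
      obtain ⟨e, he⟩ := hp.2
      by_cases hee : e = ebar
      · subst hee
        rw [ha, ha']
        rw [← B.endsG] at he
        unfold dG at key
        rcases Sym2.eq_iff.1 he with ⟨k1, k2⟩ | ⟨k1, k2⟩
        · rw [← k1, ← k2]; exact key
        · rw [← k1, ← k2]; linear_combination -key
      · exact hx p e hp hee he
    exact Prod.ext hxx hyy
  · intro xy hxy
    obtain ⟨(a : B.V → ℂ), (b : B.W → ℂ), ha, hb, h1, h2, h3⟩ := (mem_ZSet _ hloop' _ _ _).1 hxy
    have hc := hgen a b h1 h2 h3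
    let R := Relation.EqvGen (adjRel (deleteEnds B.τG ({ebar} : Set B.ℰ)))
    let s : ℂ := lam ⟨ebar, hne.symm⟩ / B.dH b ebar - B.dG a ebar
    let ind : B.V → ℂ := fun v => if R (B.eSndG ebar) v then s else 0
    have hind : ∀ e, e ≠ ebar → ∀ u v, B.τG e = s(u, v) → ind u = ind v := by
      intro e he u v huv
      have : R u v := Relation.EqvGen.rel _ _ ⟨⟨e, he⟩, huv⟩
      have : R (B.eSndG ebar) u ↔ R (B.eSndG ebar) v :=
        ⟨fun h => h.trans _ _ _ this, fun h => h.trans _ _ _ this.symm⟩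
      simp only [ind, this]
    have hdiff : ∀ e, e ≠ ebar → B.dG (a + ind) e = B.dG a e := by
      intro e he
      have := hind e he _ _ (B.endsG e).symm
      simp only [dG, Pi.add_apply, this]
      ring
    have hebar : B.dG (a + ind) ebar = lam ⟨ebar, hne.symm⟩ / B.dH b ebar := by
      have n1 : ¬ R (B.eSndG ebar) (B.eFstG ebar) :=
        cc_bridge B.τG ebar hG ((B.endsG ebar).symm.trans Sym2.eq_swap)
      have n2 : R (B.eSndG ebar) (B.eSndG ebar) := Relation.EqvGen.refl _
      have : B.dG (a + ind) ebar = B.dG a ebar + s := by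
        simp only [dG, Pi.add_apply, ind, n1, n2, if_true, if_false]
        ring
      rw [this]
      simp only [s]
      ring
    refine ⟨(fun p => (a + ind) p.1.2 - (a + ind) p.1.1, fun q => b q.1.2 - b q.1.1),
      (B.mem_ZSet hloop _ _ _).2 ⟨a + ind, b, fun _ => rfl, fun _ => rfl, ?_, h2, ?_⟩, ?_⟩
    · rw [hdiff _ hne]; exact h1
    · rintro ⟨e, he⟩
      by_cases hee : e = ebar
      · subst hee
        simp only [hebar]
        field_simp
      · rw [hdiff _ hee, ← hlam e hee he]
        exact h3 ⟨⟨e, hee⟩, fun hh => he (congrArg Subtype.val hh)⟩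
    · refine Prod.ext ?_ ?_
      · funext p
        rw [ha]
        obtain ⟨e, he⟩ := p.2.2
        have := hind e.1 e.2 _ _ he
        simp only [resMap, Pi.add_apply, this]
        ring
      · funext q
        rw [hb]
        rfl

end Bigraph

/-- If `ē` is a bridge in `G` but not in `H`, then for any other biedge
`ẽ`, `B` has Laman number `N` with respect to `ẽ` iff `(G ∖ {ē}, H ∖ {ē})` does. -/
theorem statement9 (B : Bigraph) (hloop : ¬ B.HasLoop) (hpl : B.PseudoLaman)
    (ebar : B.ℰ) (hG : IsBridge B.τG ebar) (hH : ¬ IsBridge B.τH ebar)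
    (etil : B.ℰ) (hne : etil ≠ ebar) (N : ℕ) :
    B.HasLamanNumber etil N ↔
      (B.restrict {e : B.ℰ | e ≠ ebar}).HasLamanNumber ⟨etil, hne⟩ N := by
  have hloop' : ¬ (B.restrict {e : B.ℰ | e ≠ ebar}).HasLoop := by
    rintro (⟨e, he⟩ | ⟨e, he⟩)
    · exact hloop (Or.inl ⟨e.1, he⟩)
    · exact hloop (Or.inr ⟨e.1, he⟩)
  obtain ⟨q, hq0, hq⟩ := B.generic hloop hpl ebar hG etil hne
  let emb : {e : (B.restrict {e : B.ℰ | e ≠ ebar}).ℰ // e ≠ ⟨etil, hne⟩} → {e : B.ℰ // e ≠ etil} :=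
    fun e => ⟨e.1.1, fun hh => e.2 (Subtype.ext hh)⟩
  have hemb : Function.Injective emb := by
    intro e e' h
    exact Subtype.ext (Subtype.ext (congrArg (fun z => z.1) h))
  let eb : {e : B.ℰ // e ≠ etil} := ⟨ebar, hne.symm⟩
  have main : ∀ (lam : {e : B.ℰ // e ≠ etil} → ℂ), lam eb ≠ 0 →
      MvPolynomial.eval (fun e => lam (emb e)) q ≠ 0 →
      ((B.ZSet etil lam).Finite ↔
        ((B.restrict {e : B.ℰ | e ≠ ebar}).ZSet ⟨etil, hne⟩ (fun e => lam (emb e))).Finite) ∧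
      Nat.card ↥(B.ZSet etil lam) =
        Nat.card ↥((B.restrict {e : B.ℰ | e ≠ ebar}).ZSet ⟨etil, hne⟩ (fun e => lam (emb e))) := by
    intro lam h0 hql
    have hb := B.bijOn hloop ebar hG hH etil hne hloop' lam (fun e => lam (emb e))
      (fun e he he' => rfl) h0 (by
        intro a b h1 h2 h3 h4
        apply hql
        rw [← hq a b h1 h2 h4]
        congr 2
        funext e
        exact (h3 e).symm)
    exact ⟨hb.finite_iff_finite, Nat.card_congr (hb.equiv _)⟩
  constructor
  · rintro (⟨h, -⟩ | ⟨-, P, hP0, hP⟩)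
    · exact absurd h hloop
    refine Or.inr ⟨hloop', ?_⟩
    have hne0 : P * MvPolynomial.X eb ≠ 0 := mul_ne_zero hP0 (MvPolynomial.X_ne_zero _)
    obtain ⟨pt, hpt⟩ : ∃ pt, MvPolynomial.eval pt (P * MvPolynomial.X eb) ≠ 0 := by
      by_contra hc
      push Not at hc
      exact hne0 (MvPolynomial.funext (fun x => by rw [hc x, map_zero]))
    rw [map_mul, MvPolynomial.eval_X] at hpt
    have hc0 := right_ne_zero_of_mul hpt
    have hP1 := left_ne_zero_of_mul hpt
    let ext : ({e : (B.restrict {e : B.ℰ | e ≠ ebar}).ℰ // e ≠ ⟨etil, hne⟩} → ℂ) →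
        {e : B.ℰ // e ≠ etil} → ℂ := fun l i =>
      if h : i.1 = ebar then pt eb
      else l ⟨⟨i.1, h⟩, fun hh => i.2 (congrArg Subtype.val hh)⟩
    let P' : MvPolynomial {e : (B.restrict {e : B.ℰ | e ≠ ebar}).ℰ // e ≠ ⟨etil, hne⟩} ℂ :=
      MvPolynomial.bind₁ (fun i : {e : B.ℰ // e ≠ etil} =>
        if h : i.1 = ebar then MvPolynomial.C (pt eb)
        else MvPolynomial.X ⟨⟨i.1, h⟩, fun hh => i.2 (congrArg Subtype.val hh)⟩) P
    have hP' : ∀ l, MvPolynomial.eval l P' = MvPolynomial.eval (ext l) P := by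
      intro l
      simp only [P']
      rw [MvPolynomial.eval, MvPolynomial.eval₂Hom_bind₁]
      congr 2
      funext i
      simp only [ext]
      split_ifs <;> simp
    have hext : ∀ l, (fun e => ext l (emb e)) = l := by
      intro l
      funext e
      have : ¬ (emb e).1 = ebar := e.1.2
      simp only [ext, this, dif_neg, not_false_eq_true]
      rfl
    have hexteb : ∀ l, ext l eb = pt eb := by
      intro l
      simp [ext, eb]
    have hP'0 : P' ≠ 0 := by
      intro h
      have h1 := hP' (fun e => pt (emb e))
      rw [h, map_zero] at h1
      have h2 : ext (fun e => pt (emb e)) = pt := by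
        funext i
        simp only [ext]
        split_ifs with hi
        · congr 1
          exact Subtype.ext hi.symm
        · rfl
      rw [h2] at h1
      exact hP1 h1.symm
    refine ⟨P' * q, mul_ne_zero hP'0 hq0, fun l hl => ?_⟩
    rw [map_mul] at hl
    have hl1 := left_ne_zero_of_mul hl
    have hl2 := right_ne_zero_of_mul hl
    rw [hP'] at hl1
    have hm := main (ext l) (by rw [hexteb]; exact hc0) (by rw [hext]; exact hl2)
    rw [hext] at hm
    have hh := hP _ hl1
    exact ⟨hm.1.1 hh.1, hm.2.symm.trans hh.2⟩
  · rintro (⟨h, -⟩ | ⟨-, P, hP0, hP⟩)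
    · exact absurd h hloop'
    refine Or.inr ⟨hloop, MvPolynomial.rename emb (P * q) * MvPolynomial.X eb,
      mul_ne_zero ?_ (MvPolynomial.X_ne_zero _), fun l hl => ?_⟩
    · intro h
      exact mul_ne_zero hP0 hq0 (MvPolynomial.rename_injective emb hemb (by rw [h, map_zero]))
    · rw [map_mul, MvPolynomial.eval_X, MvPolynomial.eval_rename, map_mul] at hl
      have h1 := right_ne_zero_of_mul hl
      have h2 := left_ne_zero_of_mul hl
      have hm := main l h1 (right_ne_zero_of_mul h2)
      have hh := hP _ (left_ne_zero_of_mul h2)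
      exact ⟨hm.1.2 hh.1, hm.2.trans hh.2⟩

end LamanPaper
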